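/- arXiv:2112.05950 — 8 statements merged into one kernel-verified Lean document; each statement's English description precedes it below -/
import Mathlib

section
/- For all real parameters c1, c2, c3 > 0, k > 0 and l in [0,1], the point E1 = (c2/(c1+c2)^2, c1/(c1+c2)^2, 0) is a fixed point of the map T_ANB, i.e. T_ANB(E1) = E1. -/
/-- The triopoly map `T_ANB` (adaptive / naive / boundedly rational). -/
noncomputable def T_ANB (c1 c2 c3 k l : ℝ) (p : ℝ × ℝ × ℝ) : ℝ × ℝ × ℝ :=
  ((1 - l) * p.1 + l * (Real.sqrt ((p.2.1 + p.2.2) / c1) - p.2.1 - p.2.2),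
   Real.sqrt ((p.1 + p.2.2) / c2) - p.1 - p.2.2,
   p.2.2 + k * p.2.2 * ((p.1 + p.2.1) / (p.1 + p.2.1 + p.2.2) ^ 2 - c3))

theorem sqrt_div_sq_div_self {c s : ℝ} (hc : 0 < c) (hs : 0 < s) :
    Real.sqrt (c / s ^ 2 / c) = 1 / s := by
  have h : c / s ^ 2 / c = (1 / s) ^ 2 := by field_simp
  rw [h, Real.sqrt_sq (by positivity)]

theorem E1_fixed_point_T_ANB (c1 c2 c3 k l : ℝ)
    (hc1 : 0 < c1) (hc2 : 0 < c2) (hc3 : 0 < c3) (hk : 0 < k)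
    (hl : l ∈ Set.Icc (0 : ℝ) 1) :
    T_ANB c1 c2 c3 k l (c2 / (c1 + c2) ^ 2, c1 / (c1 + c2) ^ 2, 0) =
      (c2 / (c1 + c2) ^ 2, c1 / (c1 + c2) ^ 2, 0) := by
  have hs : 0 < c1 + c2 := add_pos hc1 hc2
  have h1 := sqrt_div_sq_div_self hc1 hs
  have h2 := sqrt_div_sq_div_self hc2 hs
  simp only [T_ANB, add_zero, sub_zero, h1, h2, Prod.mk.injEq]
  refine ⟨?_, ?_, ?_⟩
  · field_simp
    ring
  · field_simp
    ring
  · ring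
end

section
/- For all real parameters c1, c2, c3 > 0, k > 0 and l in [0,1], writing s = c1+c2+c3, the point E2 = (2*(c2+c3-c1)/s^2, 2*(c1+c3-c2)/s^2, 2*(c1+c2-c3)/s^2) is a fixed point of the map T_ANB, i.e. T_ANB(E2) = E2. -/
/-- If the rivals of a firm with marginal cost `c` jointly produce `4 * c / s ^ 2`, the square root
in its best response equals `2 / s`. -/
lemma sqrt_div_cost_eq {c s w : ℝ} (hc : 0 < c) (hs : 0 < s) (hw : w = 4 * c / s ^ 2) :
    Real.sqrt (w / c) = 2 / s := by
  have h : w / c = (2 / s) ^ 2 := by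
    rw [hw]
    field_simp
    norm_num
  rw [h, Real.sqrt_sq (by positivity)]

theorem E2_fixed_point_T_ANB (c1 c2 c3 k l : ℝ)
    (hc1 : 0 < c1) (hc2 : 0 < c2) (hc3 : 0 < c3) (hk : 0 < k)
    (hl : l ∈ Set.Icc (0 : ℝ) 1) :
    T_ANB c1 c2 c3 k l
      (2 * (c2 + c3 - c1) / (c1 + c2 + c3) ^ 2,
       2 * (c1 + c3 - c2) / (c1 + c2 + c3) ^ 2,
       2 * (c1 + c2 - c3) / (c1 + c2 + c3) ^ 2) =
      (2 * (c2 + c3 - c1) / (c1 + c2 + c3) ^ 2,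
       2 * (c1 + c3 - c2) / (c1 + c2 + c3) ^ 2,
       2 * (c1 + c2 - c3) / (c1 + c2 + c3) ^ 2) := by
  have hs : 0 < c1 + c2 + c3 := by positivity
  have total : 2 * (c2 + c3 - c1) / (c1 + c2 + c3) ^ 2 + 2 * (c1 + c3 - c2) / (c1 + c2 + c3) ^ 2
      + 2 * (c1 + c2 - c3) / (c1 + c2 + c3) ^ 2 = 2 / (c1 + c2 + c3) := by
    field_simp
    ring
  simp only [T_ANB, Prod.mk.injEq]
  refine ⟨?_, ?_, ?_⟩
  · rw [sqrt_div_cost_eq hc1 hs (by ring)]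
    linear_combination (-l) * total
  · rw [sqrt_div_cost_eq hc2 hs (by ring)]
    linear_combination -total
  · have h : (2 * (c2 + c3 - c1) / (c1 + c2 + c3) ^ 2 + 2 * (c1 + c3 - c2) / (c1 + c2 + c3) ^ 2)
        / (2 / (c1 + c2 + c3)) ^ 2 = c3 := by
      field_simp
      ring
    rw [total, h, sub_self, mul_zero, add_zero]
end

section
/- For all real parameters c1, c2, c3 > 0 and k > 0, writing s = c1+c2+c3, the point E2 = (2*(c2+c3-c1)/s^2, 2*(c1+c3-c2)/s^2, 2*(c1+c2-c3)/s^2) is a fixed point of the map T_LNB, i.e. T_LNB(E2) = E2. -/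
/-- The triopoly map `T_LNB` (LMA / naive / boundedly rational). -/
noncomputable def T_LNB (c1 c2 c3 k : ℝ) (p : ℝ × ℝ × ℝ) : ℝ × ℝ × ℝ :=
  ((2 * p.1 + p.2.1 + p.2.2 - c1 * (p.1 + p.2.1 + p.2.2) ^ 2) / 2,
   Real.sqrt ((p.1 + p.2.2) / c2) - p.1 - p.2.2,
   p.2.2 + k * p.2.2 * ((p.1 + p.2.1) / (p.1 + p.2.1 + p.2.2) ^ 2 - c3))

theorem E2_fixed_point_T_LNB (c1 c2 c3 k : ℝ)
    (hc1 : 0 < c1) (hc2 : 0 < c2) (hc3 : 0 < c3) (hk : 0 < k) :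
    T_LNB c1 c2 c3 k
      (2 * (c2 + c3 - c1) / (c1 + c2 + c3) ^ 2,
       2 * (c1 + c3 - c2) / (c1 + c2 + c3) ^ 2,
       2 * (c1 + c2 - c3) / (c1 + c2 + c3) ^ 2) =
      (2 * (c2 + c3 - c1) / (c1 + c2 + c3) ^ 2,
       2 * (c1 + c3 - c2) / (c1 + c2 + c3) ^ 2,
       2 * (c1 + c2 - c3) / (c1 + c2 + c3) ^ 2) := by
  have hs : c1 + c2 + c3 ≠ 0 := by positivity
  have hsum : 2 * (c2 + c3 - c1) / (c1 + c2 + c3) ^ 2 +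
      2 * (c1 + c3 - c2) / (c1 + c2 + c3) ^ 2 +
      2 * (c1 + c2 - c3) / (c1 + c2 + c3) ^ 2 = 2 / (c1 + c2 + c3) := by
    field_simp
    ring
  have hsqrt : Real.sqrt ((2 * (c2 + c3 - c1) / (c1 + c2 + c3) ^ 2 +
      2 * (c1 + c2 - c3) / (c1 + c2 + c3) ^ 2) / c2) = 2 / (c1 + c2 + c3) := by
    rw [Real.sqrt_eq_iff_mul_self_eq_of_pos (by positivity)]
    field_simp
    ring
  simp only [T_LNB, hsum, hsqrt, Prod.mk.injEq]
  refine ⟨?_, ?_, ?_⟩ <;>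
  · field_simp
    ring
end

section
/- Let c > 0, k > 0 and l in [0,1] be real numbers, and set c1 = c2 = c3 = c, so that E2 = (2/(9c), 2/(9c), 2/(9c)). Then -1 is an eigenvalue of the matrix J_ABG evaluated at E2 (i.e. det(J_ABG(E2) + I) = 0) if and only if 33*c*k*l - 68*c*k - 102*l + 192 = 0. -/
/-- Jacobian matrix of the `T_ANB` model at the point `(x, y, z)`. -/
noncomputable def J_ABG (c1 c2 c3 k l x y z : ℝ) : Matrix (Fin 3) (Fin 3) ℝ :=
  !![1 - l, l * (1 / (2 * c1) * Real.sqrt (c1 / (y + z)) - 1),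
       l * (1 / (2 * c1) * Real.sqrt (c1 / (y + z)) - 1);
     1 / (2 * c2) * Real.sqrt (c2 / (x + z)) - 1, 0,
       1 / (2 * c2) * Real.sqrt (c2 / (x + z)) - 1;
     k * z * (z - x - y) / (x + y + z) ^ 3, k * z * (z - x - y) / (x + y + z) ^ 3,
       1 - k * c3 + k * (x + y) * (x + y - z) / (x + y + z) ^ 3]

/-- The interior equilibrium `E2`. -/
noncomputable def E2 (c1 c2 c3 : ℝ) : ℝ × ℝ × ℝ :=
  (2 * (c2 + c3 - c1) / (c1 + c2 + c3) ^ 2,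
   2 * (c1 + c3 - c2) / (c1 + c2 + c3) ^ 2,
   2 * (c1 + c2 - c3) / (c1 + c2 + c3) ^ 2)

/-- The Jacobian at the equilibrium when the marginal costs coincide. -/
theorem J_ABG_E2_identical_costs {c : ℝ} (hc : 0 < c) (k l : ℝ) :
    J_ABG c c c k l (E2 c c c).1 (E2 c c c).2.1 (E2 c c c).2.2 =
      !![1 - l, -(l / 4), -(l / 4);
         -(1 / 4), 0, -(1 / 4);
         -(c * k / 6), -(c * k / 6), 1 - 2 * (c * k) / 3] := by
  have h_coord : 2 * (c + c - c) / (c + c + c) ^ 2 = 2 / (9 * c) := by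
    field_simp
    ring
  have h_sqrt : Real.sqrt (c / (2 / (9 * c) + 2 / (9 * c))) = 3 * c / 2 := by
    rw [show c / (2 / (9 * c) + 2 / (9 * c)) = (3 * c / 2) ^ 2 by field_simp; ring]
    exact Real.sqrt_sq (by positivity)
  simp only [J_ABG, E2, h_coord, h_sqrt]
  ext i j
  fin_cases i <;> fin_cases j <;> simp <;> field_simp <;> ring

/-- Period-doubling (flip) eigenvalue-assignment condition for the `T_ANB`
model with identical marginal costs: `-1` is an eigenvalue of the Jacobian at
`E2` iff `33*c*k*l - 68*c*k - 102*l + 192 = 0`. -/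
theorem T_ANB_flip_identical_costs (c k l : ℝ)
    (hc : 0 < c) (hk : 0 < k) (hl : l ∈ Set.Icc (0 : ℝ) 1) :
    (J_ABG c c c k l (E2 c c c).1 (E2 c c c).2.1 (E2 c c c).2.2 + 1).det = 0 ↔
      33 * c * k * l - 68 * c * k - 102 * l + 192 = 0 := by
  rw [J_ABG_E2_identical_costs hc]
  simp only [Matrix.det_fin_three, Matrix.add_apply, Matrix.one_apply]
  simp
  constructor <;> intro h <;> linarith
end

section
/- Let c > 0 and k > 0 be real numbers, and set c1 = c2 = c3 = c, so that E2 = (2/(9c), 2/(9c), 2/(9c)). Then -1 is an eigenvalue of the matrix J_LBG evaluated at E2 (i.e. det(J_LBG(E2) + I) = 0) if and only if 23*c*k = 62. -/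
/-- Jacobian matrix of the `T_LNB` model at the point `(x, y, z)`. -/
noncomputable def J_LBG (c1 c2 c3 k x y z : ℝ) : Matrix (Fin 3) (Fin 3) ℝ :=
  !![1 - c1 * (x + y + z), 1 / 2 - c1 * (x + y + z), 1 / 2 - c1 * (x + y + z);
     1 / (2 * c2) * Real.sqrt (c2 / (x + z)) - 1, 0,
       1 / (2 * c2) * Real.sqrt (c2 / (x + z)) - 1;
     k * z * (z - x - y) / (x + y + z) ^ 3, k * z * (z - x - y) / (x + y + z) ^ 3,
       1 - k * c3 + k * (x + y) * (x + y - z) / (x + y + z) ^ 3]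

/-- The Jacobian at the equilibrium `E2` when all three marginal costs equal `c`. -/
lemma J_LBG_E2_identical_costs (c k : ℝ) (hc : 0 < c) :
    J_LBG c c c k (E2 c c c).1 (E2 c c c).2.1 (E2 c c c).2.2 =
      !![1 / 3, -1 / 6, -1 / 6;
         -1 / 4, 0, -1 / 4;
         -(c * k) / 6, -(c * k) / 6, 1 - 2 * (c * k) / 3] := by
  have hx : 2 * (c + c - c) / (c + c + c) ^ 2 = 2 / (9 * c) := by
    field_simp
    ring
  have hsqrt : Real.sqrt (c / (2 / (9 * c) + 2 / (9 * c))) = 3 * c / 2 := by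
    rw [show c / (2 / (9 * c) + 2 / (9 * c)) = (3 * c / 2) ^ 2 by field_simp; ring]
    exact Real.sqrt_sq (by positivity)
  simp only [J_LBG, E2, hx, hsqrt]
  ext i j
  fin_cases i <;> fin_cases j <;> simp <;> field_simp <;> ring

/-- Period-doubling (flip) eigenvalue-assignment condition for the `T_LNB`
model with identical marginal costs: `-1` is an eigenvalue of the Jacobian at
`E2` iff `23*c*k = 62`. -/
theorem T_LNB_flip_identical_costs (c k : ℝ) (hc : 0 < c) (hk : 0 < k) :
    (J_LBG c c c k (E2 c c c).1 (E2 c c c).2.1 (E2 c c c).2.2 + 1).det = 0 ↔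
      23 * c * k = 62 := by
  rw [J_LBG_E2_identical_costs c k hc, Matrix.det_fin_three]
  simp
  constructor <;> intro h <;> linarith
end

section
/- Let c1, c2, c3 > 0, k > 0 and l in [0,1] be real numbers with c2+c3 > c1, c1+c3 > c2 and c1+c2 > c3 (so that all three components of E2 are positive). Then -1 is an eigenvalue of the matrix J_ABG evaluated at E2 (i.e. det(J_ABG(E2) + I) = 0) if and only if PD_ANB = 0, where PD_ANB = k*l*c3^4 + (2*c1*k*l - 10*c2*k*l - 12*c1*k - 2*l)*c3^3 + (-12*c1*c2*k*l + 4*c2^2*k*l + 4*c1^2*k + 116*c1*c2*k + 2*c1*l + 2*c2*l)*c3^2 + (-2*c1^3*k*l + 6*c1^2*c2*k*l + 18*c1*c2^2*k*l + 10*c2^3*k*l + 12*c1^3*k - 104*c1^2*c2*k - 116*c1*c2^2*k + 10*c1^2*l - 44*c1*c2*l + 10*c2^2*l + 64*c1*c2)*c3 - c1^4*k*l + 8*c1^3*c2*k*l + 14*c1^2*c2^2*k*l - 5*c2^4*k*l - 4*c1^4*k + 4*c1^3*c2*k + 20*c1^2*c2^2*k + 12*c1*c2^3*k + 6*c1^3*l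 - 46*c1^2*c2*l - 46*c1*c2^2*l + 6*c2^3*l + 64*c1^2*c2 + 64*c1*c2^2. -/
/-- The reaction-curve slope term takes a rational value where the rivals' total output is
`4 * c / s ^ 2`. -/
theorem sqrt_term_of_equilibrium {c s : ℝ} (hc : 0 < c) (hs : 0 < s) :
    1 / (2 * c) * Real.sqrt (c / (4 * c / s ^ 2)) - 1 = s / (4 * c) - 1 := by
  have h : c / (4 * c / s ^ 2) = (s / 2) ^ 2 := by
    field_simp
    norm_num
  rw [h, Real.sqrt_sq (by positivity)]
  ring

/-- The Jacobian at the interior equilibrium is a rational function of the parameters. -/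
theorem J_ABG_E2 {c1 c2 c3 : ℝ} (k l : ℝ) (hc1 : 0 < c1) (hc2 : 0 < c2) (hc3 : 0 < c3) :
    J_ABG c1 c2 c3 k l (E2 c1 c2 c3).1 (E2 c1 c2 c3).2.1 (E2 c1 c2 c3).2.2 =
      !![1 - l, l * ((c1 + c2 + c3) / (4 * c1) - 1), l * ((c1 + c2 + c3) / (4 * c1) - 1);
        (c1 + c2 + c3) / (4 * c2) - 1, 0, (c1 + c2 + c3) / (4 * c2) - 1;
        k * (c1 + c2 - c3) * (c1 + c2 - 3 * c3) / (2 * (c1 + c2 + c3)),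
        k * (c1 + c2 - c3) * (c1 + c2 - 3 * c3) / (2 * (c1 + c2 + c3)),
        1 - k * c3 + k * c3 * (3 * c3 - c1 - c2) / (c1 + c2 + c3)] := by
  have hs : 0 < c1 + c2 + c3 := by positivity
  have hyz : 2 * (c1 + c3 - c2) / (c1 + c2 + c3) ^ 2 + 2 * (c1 + c2 - c3) / (c1 + c2 + c3) ^ 2 =
      4 * c1 / (c1 + c2 + c3) ^ 2 := by ring
  have hxz : 2 * (c2 + c3 - c1) / (c1 + c2 + c3) ^ 2 + 2 * (c1 + c2 - c3) / (c1 + c2 + c3) ^ 2 =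
      4 * c2 / (c1 + c2 + c3) ^ 2 := by ring
  have hxyz : 2 * (c2 + c3 - c1) / (c1 + c2 + c3) ^ 2 + 2 * (c1 + c3 - c2) / (c1 + c2 + c3) ^ 2 +
      2 * (c1 + c2 - c3) / (c1 + c2 + c3) ^ 2 = 2 / (c1 + c2 + c3) := by
    field_simp
    ring
  simp only [J_ABG, E2]
  rw [hyz, hxz, hxyz, sqrt_term_of_equilibrium hc1 hs, sqrt_term_of_equilibrium hc2 hs]
  ext i j
  fin_cases i <;> fin_cases j <;> simp <;> field_simp <;> ring

/-- Period-doubling bifurcation surface of the `T_ANB` model: `-1` is an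
eigenvalue of the Jacobian at the positive equilibrium `E2` iff
`PD_ANB = 0`. -/
theorem T_ANB_flip_surface (c1 c2 c3 k l : ℝ)
    (hc1 : 0 < c1) (hc2 : 0 < c2) (hc3 : 0 < c3) (hk : 0 < k)
    (hl : l ∈ Set.Icc (0 : ℝ) 1)
    (h1 : c1 < c2 + c3) (h2 : c2 < c1 + c3) (h3 : c3 < c1 + c2) :
    (J_ABG c1 c2 c3 k l (E2 c1 c2 c3).1 (E2 c1 c2 c3).2.1
        (E2 c1 c2 c3).2.2 + 1).det = 0 ↔
      k * l * c3 ^ 4 +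
          (2 * c1 * k * l - 10 * c2 * k * l - 12 * c1 * k - 2 * l) * c3 ^ 3 +
          (-12 * c1 * c2 * k * l + 4 * c2 ^ 2 * k * l + 4 * c1 ^ 2 * k +
              116 * c1 * c2 * k + 2 * c1 * l + 2 * c2 * l) * c3 ^ 2 +
          (-2 * c1 ^ 3 * k * l + 6 * c1 ^ 2 * c2 * k * l +
              18 * c1 * c2 ^ 2 * k * l + 10 * c2 ^ 3 * k * l + 12 * c1 ^ 3 * k -
              104 * c1 ^ 2 * c2 * k - 116 * c1 * c2 ^ 2 * k + 10 * c1 ^ 2 * l -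
              44 * c1 * c2 * l + 10 * c2 ^ 2 * l + 64 * c1 * c2) * c3 -
          c1 ^ 4 * k * l + 8 * c1 ^ 3 * c2 * k * l +
          14 * c1 ^ 2 * c2 ^ 2 * k * l - 5 * c2 ^ 4 * k * l - 4 * c1 ^ 4 * k +
          4 * c1 ^ 3 * c2 * k + 20 * c1 ^ 2 * c2 ^ 2 * k +
          12 * c1 * c2 ^ 3 * k + 6 * c1 ^ 3 * l - 46 * c1 ^ 2 * c2 * l -
          46 * c1 * c2 ^ 2 * l + 6 * c2 ^ 3 * l + 64 * c1 ^ 2 * c2 +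
          64 * c1 * c2 ^ 2 = 0 := by
  rw [J_ABG_E2 k l hc1 hc2 hc3]
  have hs : c1 + c2 + c3 ≠ 0 := by positivity
  have hfactor : 16 * (c1 + c2 + c3) * c1 * c2 ≠ 0 := by positivity
  rw [← mul_right_inj' hfactor, mul_zero]
  refine Eq.congr_left ?_
  simp [Matrix.det_fin_three]
  field_simp
  ring
end

section
/- Let c1, c2, c3 > 0 and k > 0 be real numbers with c2+c3 > c1, c1+c3 > c2 and c1+c2 > c3 (so that all three components of E2 are positive). Then -1 is an eigenvalue of the matrix J_LBG evaluated at E2 (i.e. det(J_LBG(E2) + I) = 0) if and only if PD_LNB = 0, where PD_LNB = (3*c1^3 - 11*c1^2*c2 - 5*c1^2*c3 - 15*c1*c2^2 + 54*c1*c2*c3 - 3*c1*c3^2 - c2^3 + 43*c2^2*c3 - 47*c2*c3^2 + 5*c3^3)*k - 6*c1^2 + 20*c1*c2 - 4*c1*c3 - 38*c2^2 - 36*c2*c3 + 2*c3^2. -/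
/-- At `E2` the square root in the Jacobian simplifies to half the total cost. -/
theorem sqrt_div_E2 (c1 c2 c3 : ℝ) (hc2 : c2 ≠ 0) (hs : 0 < c1 + c2 + c3) :
    Real.sqrt (c2 / ((E2 c1 c2 c3).1 + (E2 c1 c2 c3).2.2)) = (c1 + c2 + c3) / 2 := by
  have h : c2 / ((E2 c1 c2 c3).1 + (E2 c1 c2 c3).2.2) = ((c1 + c2 + c3) / 2) ^ 2 := by
    have hsum : (E2 c1 c2 c3).1 + (E2 c1 c2 c3).2.2 = 4 * c2 / (c1 + c2 + c3) ^ 2 := by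
      simp only [E2]
      ring
    rw [hsum]
    field_simp
    norm_num
  rw [h, Real.sqrt_sq (by positivity)]

theorem sum_E2 (c1 c2 c3 : ℝ) (hs : c1 + c2 + c3 ≠ 0) :
    (E2 c1 c2 c3).1 + (E2 c1 c2 c3).2.1 + (E2 c1 c2 c3).2.2 = 2 / (c1 + c2 + c3) := by
  simp only [E2]
  field_simp
  ring

theorem det_J_LBG_E2_add_one (c1 c2 c3 k : ℝ) (hc2 : c2 ≠ 0) (hs : 0 < c1 + c2 + c3) :
    (J_LBG c1 c2 c3 k (E2 c1 c2 c3).1 (E2 c1 c2 c3).2.1 (E2 c1 c2 c3).2.2 + 1).det =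
      -((3 * c1 ^ 3 - 11 * c1 ^ 2 * c2 - 5 * c1 ^ 2 * c3 - 15 * c1 * c2 ^ 2 +
            54 * c1 * c2 * c3 - 3 * c1 * c3 ^ 2 - c2 ^ 3 + 43 * c2 ^ 2 * c3 -
            47 * c2 * c3 ^ 2 + 5 * c3 ^ 3) * k -
          6 * c1 ^ 2 + 20 * c1 * c2 - 4 * c1 * c3 - 38 * c2 ^ 2 -
          36 * c2 * c3 + 2 * c3 ^ 2) /
        (8 * c2 * (c1 + c2 + c3)) := by
  have hs' := hs.ne'
  simp only [J_LBG, sqrt_div_E2 c1 c2 c3 hc2 hs, sum_E2 c1 c2 c3 hs', Matrix.det_fin_three]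
  simp [E2]
  field_simp
  ring

/-- Period-doubling bifurcation surface of the `T_LNB` model: `-1` is an
eigenvalue of the Jacobian at the positive equilibrium `E2` iff
`PD_LNB = 0`. -/
theorem T_LNB_flip_surface (c1 c2 c3 k : ℝ)
    (hc1 : 0 < c1) (hc2 : 0 < c2) (hc3 : 0 < c3) (hk : 0 < k)
    (h1 : c1 < c2 + c3) (h2 : c2 < c1 + c3) (h3 : c3 < c1 + c2) :
    (J_LBG c1 c2 c3 k (E2 c1 c2 c3).1 (E2 c1 c2 c3).2.1
        (E2 c1 c2 c3).2.2 + 1).det = 0 ↔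
      (3 * c1 ^ 3 - 11 * c1 ^ 2 * c2 - 5 * c1 ^ 2 * c3 - 15 * c1 * c2 ^ 2 +
            54 * c1 * c2 * c3 - 3 * c1 * c3 ^ 2 - c2 ^ 3 + 43 * c2 ^ 2 * c3 -
            47 * c2 * c3 ^ 2 + 5 * c3 ^ 3) * k -
          6 * c1 ^ 2 + 20 * c1 * c2 - 4 * c1 * c3 - 38 * c2 ^ 2 -
          36 * c2 * c3 + 2 * c3 ^ 2 = 0 := by
  have hs : 0 < c1 + c2 + c3 := by positivity
  rw [det_J_LBG_E2_add_one c1 c2 c3 k hc2.ne' hs, div_eq_zero_iff, neg_eq_zero,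
    or_iff_left (by positivity)]
end

section
/- Let c1, c2, c3 > 0 and k > 0 be real numbers with c2+c3 > c1, c1+c3 > c2 and c1+c2 > c3 (so that all three components of E2 are positive), and let a0, a1, a2 be the real numbers such that the characteristic polynomial of the matrix J_LBG evaluated at E2 is lambda^3 + a2*lambda^2 + a1*lambda + a0. Then -a0^2 + a0*a2 - a1 + 1 = 0 if and only if NS_LNB = 0, where NS_LNB = 4*k^2*c3^6 + (-8*c1*k^2 + 4*k)*c3^5 + (-4*c1^2*k^2 + 16*c1*c2*k^2 - 72*c2^2*k^2 - 12*c1*k + 1)*c3^4 + (16*c1^3*k^2 - 32*c1^2*c2*k^2 + 112*c1*c2^2*k^2 + 128*c2^3*k^2 - 8*c1^2*k + 8*c1*c2*k + 48*c2^2*k - 4*c1 + 4*c2)*c3^3 + (-4*c1^4*k^2 - 16*c1^2*c2^2*k^2 - 144*c1*c2^3*k^2 - 60*c2^4*k^2 + 24*c1^3*k - 56*c1^2*c2*k + 136*c1*c2^2*k - 8*c2^3*k - 2*c1^2 + 4*c1*c2 - 10*c2^2)*c3^2 + (-8*c1^5*k^2 + 32*c1^4*c2*k^2 - 16*c1^3*c2^2*k^2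 - 32*c1^2*c2^3*k^2 + 24*c1*c2^4*k^2 + 4*c1^4*k - 8*c1^3*c2*k - 80*c1^2*c2^2*k - 248*c1*c2^3*k - 52*c2^4*k + 12*c1^3 - 36*c1^2*c2 - 76*c1*c2^2 - 28*c2^3)*c3 + 4*c1^6*k^2 - 16*c1^5*c2*k^2 - 8*c1^4*c2^2*k^2 + 48*c1^3*c2^3*k^2 + 36*c1^2*c2^4*k^2 - 12*c1^5*k + 56*c1^4*c2*k + 24*c1^3*c2^2*k - 32*c1^2*c2^3*k + 20*c1*c2^4*k + 8*c2^5*k + 9*c1^4 - 36*c1^3*c2 - 114*c1^2*c2^2 - 84*c1*c2^3 - 15*c2^4. -/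
open Polynomial

/-- The coefficients of the characteristic polynomial of a `3 × 3` matrix in terms of its
entries. -/
lemma charpoly_coeffs_of_fin_three (a b c d e f g h i a0 a1 a2 : ℝ)
    (hchar : (!![a, b, c; d, e, f; g, h, i] : Matrix (Fin 3) (Fin 3) ℝ).charpoly =
      X ^ 3 + C a2 * X ^ 2 + C a1 * X + C a0) :
    a2 = -(a + e + i) ∧
      a1 = a * e - b * d + (a * i - c * g) + (e * i - f * h) ∧
      a0 = -(a * (e * i - f * h) - b * (d * i - f * g) + c * (d * h - e * g)) := by
  have key : ∀ t : ℝ, (t - a) * ((t - e) * (t - i) - f * h) - b * (d * (t - i) + f * g)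
      - c * (d * h + (t - e) * g) = t ^ 3 + a2 * t ^ 2 + a1 * t + a0 := by
    intro t
    have ht := congrArg (Polynomial.eval t) hchar
    rw [Matrix.eval_charpoly, Matrix.det_fin_three] at ht
    simp [Matrix.scalar_apply] at ht
    linear_combination ht
  have h0 := key 0
  have h1 := key 1
  have h2 := key (-1)
  refine ⟨?_, ?_, ?_⟩
  · linear_combination -(h1 + h2) / 2 + h0
  · linear_combination -(h1 - h2) / 2
  · linear_combination -h0

lemma sqrt_div_E2_fst_add_E2_snd_snd {c1 c2 c3 : ℝ} (hc2 : 0 < c2) (hs : 0 < c1 + c2 + c3) :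
    Real.sqrt (c2 / ((E2 c1 c2 c3).1 + (E2 c1 c2 c3).2.2)) = (c1 + c2 + c3) / 2 := by
  have h : c2 / ((E2 c1 c2 c3).1 + (E2 c1 c2 c3).2.2) = ((c1 + c2 + c3) / 2) ^ 2 := by
    have hsum : (E2 c1 c2 c3).1 + (E2 c1 c2 c3).2.2 = 4 * c2 / (c1 + c2 + c3) ^ 2 := by
      simp only [E2]
      ring
    rw [hsum]
    field_simp
    norm_num
  rw [h, Real.sqrt_sq (by positivity)]

lemma J_LBG_E2 {c1 c2 c3 : ℝ} (k : ℝ) (hc2 : 0 < c2) (hs : 0 < c1 + c2 + c3) :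
    J_LBG c1 c2 c3 k (E2 c1 c2 c3).1 (E2 c1 c2 c3).2.1 (E2 c1 c2 c3).2.2 =
      !![1 - 2 * c1 / (c1 + c2 + c3), 1 / 2 - 2 * c1 / (c1 + c2 + c3),
          1 / 2 - 2 * c1 / (c1 + c2 + c3);
        (c1 + c2 + c3) / (4 * c2) - 1, 0, (c1 + c2 + c3) / (4 * c2) - 1;
        k * (c1 + c2 - c3) * (c1 + c2 - 3 * c3) / (2 * (c1 + c2 + c3)),
          k * (c1 + c2 - c3) * (c1 + c2 - 3 * c3) / (2 * (c1 + c2 + c3)),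
          1 - k * c3 + k * c3 * (3 * c3 - c1 - c2) / (c1 + c2 + c3)] := by
  have hsum : (E2 c1 c2 c3).1 + (E2 c1 c2 c3).2.1 + (E2 c1 c2 c3).2.2 =
      2 / (c1 + c2 + c3) := by
    simp only [E2]
    field_simp
    ring
  have hrow2 : 1 / (2 * c2) * ((c1 + c2 + c3) / 2) - 1 = (c1 + c2 + c3) / (4 * c2) - 1 := by
    field_simp
    ring
  have hrow3 : k * (E2 c1 c2 c3).2.2 *
      ((E2 c1 c2 c3).2.2 - (E2 c1 c2 c3).1 - (E2 c1 c2 c3).2.1) / (2 / (c1 + c2 + c3)) ^ 3 =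
      k * (c1 + c2 - c3) * (c1 + c2 - 3 * c3) / (2 * (c1 + c2 + c3)) := by
    simp only [E2]
    field_simp
    ring
  have hdiag : k * ((E2 c1 c2 c3).1 + (E2 c1 c2 c3).2.1) *
      ((E2 c1 c2 c3).1 + (E2 c1 c2 c3).2.1 - (E2 c1 c2 c3).2.2) / (2 / (c1 + c2 + c3)) ^ 3 =
      k * c3 * (3 * c3 - c1 - c2) / (c1 + c2 + c3) := by
    simp only [E2]
    field_simp
    ring
  rw [J_LBG, sqrt_div_E2_fst_add_E2_snd_snd hc2 hs, hsum, hrow2, hrow3, hdiag,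
    mul_div_left_comm, ← mul_div_assoc]

/-- Neimark-Sacker bifurcation surface of the `T_LNB` model: writing the
characteristic polynomial of the Jacobian at the positive equilibrium `E2` as
`λ^3 + a2*λ^2 + a1*λ + a0`, the Schur-Cohn quantity `-a0^2 + a0*a2 - a1 + 1`
vanishes iff `NS_LNB = 0`. -/
theorem T_LNB_neimark_sacker_surface (c1 c2 c3 k a0 a1 a2 : ℝ)
    (hc1 : 0 < c1) (hc2 : 0 < c2) (hc3 : 0 < c3) (hk : 0 < k)
    (h1 : c1 < c2 + c3) (h2 : c2 < c1 + c3) (h3 : c3 < c1 + c2)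
    (hchar : (J_LBG c1 c2 c3 k (E2 c1 c2 c3).1 (E2 c1 c2 c3).2.1
        (E2 c1 c2 c3).2.2).charpoly =
      X ^ 3 + C a2 * X ^ 2 + C a1 * X + C a0) :
    -a0 ^ 2 + a0 * a2 - a1 + 1 = 0 ↔
      4 * k ^ 2 * c3 ^ 6 + (-8 * c1 * k ^ 2 + 4 * k) * c3 ^ 5 +
          (-4 * c1 ^ 2 * k ^ 2 + 16 * c1 * c2 * k ^ 2 - 72 * c2 ^ 2 * k ^ 2 -
              12 * c1 * k + 1) * c3 ^ 4 +
          (16 * c1 ^ 3 * k ^ 2 - 32 * c1 ^ 2 * c2 * k ^ 2 +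
              112 * c1 * c2 ^ 2 * k ^ 2 + 128 * c2 ^ 3 * k ^ 2 -
              8 * c1 ^ 2 * k + 8 * c1 * c2 * k + 48 * c2 ^ 2 * k - 4 * c1 +
              4 * c2) * c3 ^ 3 +
          (-4 * c1 ^ 4 * k ^ 2 - 16 * c1 ^ 2 * c2 ^ 2 * k ^ 2 -
              144 * c1 * c2 ^ 3 * k ^ 2 - 60 * c2 ^ 4 * k ^ 2 +
              24 * c1 ^ 3 * k - 56 * c1 ^ 2 * c2 * k + 136 * c1 * c2 ^ 2 * k -
              8 * c2 ^ 3 * k - 2 * c1 ^ 2 + 4 * c1 * c2 - 10 * c2 ^ 2) *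
            c3 ^ 2 +
          (-8 * c1 ^ 5 * k ^ 2 + 32 * c1 ^ 4 * c2 * k ^ 2 -
              16 * c1 ^ 3 * c2 ^ 2 * k ^ 2 - 32 * c1 ^ 2 * c2 ^ 3 * k ^ 2 +
              24 * c1 * c2 ^ 4 * k ^ 2 + 4 * c1 ^ 4 * k - 8 * c1 ^ 3 * c2 * k -
              80 * c1 ^ 2 * c2 ^ 2 * k - 248 * c1 * c2 ^ 3 * k -
              52 * c2 ^ 4 * k + 12 * c1 ^ 3 - 36 * c1 ^ 2 * c2 -
              76 * c1 * c2 ^ 2 - 28 * c2 ^ 3) * c3 +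
          4 * c1 ^ 6 * k ^ 2 - 16 * c1 ^ 5 * c2 * k ^ 2 -
          8 * c1 ^ 4 * c2 ^ 2 * k ^ 2 + 48 * c1 ^ 3 * c2 ^ 3 * k ^ 2 +
          36 * c1 ^ 2 * c2 ^ 4 * k ^ 2 - 12 * c1 ^ 5 * k +
          56 * c1 ^ 4 * c2 * k + 24 * c1 ^ 3 * c2 ^ 2 * k -
          32 * c1 ^ 2 * c2 ^ 3 * k + 20 * c1 * c2 ^ 4 * k + 8 * c2 ^ 5 * k +
          9 * c1 ^ 4 - 36 * c1 ^ 3 * c2 - 114 * c1 ^ 2 * c2 ^ 2 -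
          84 * c1 * c2 ^ 3 - 15 * c2 ^ 4 = 0 := by
  have hs : 0 < c1 + c2 + c3 := by positivity
  rw [J_LBG_E2 k hc2 hs] at hchar
  obtain ⟨ha2, ha1, ha0⟩ := charpoly_coeffs_of_fin_three _ _ _ _ _ _ _ _ _ _ _ _ hchar
  have hscale : 64 * (c1 + c2 + c3) ^ 2 * c2 ^ 2 ≠ 0 := by positivity
  rw [← mul_eq_zero_iff_left hscale, ← neg_eq_zero]
  refine Eq.congr_left ?_
  rw [ha0, ha1, ha2]
  field_simp
  ring
end
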